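/- For every multi-index k ∈ ℕ^d, every x ∈ ℝ^d, and every z ∈ ℂ^d, the iterated holomorphic partial derivative (∂/∂z)^k G(x,z) := ∂_{z_1}^{k_1} ⋯ ∂_{z_d}^{k_d} G(x,z) equals P̃_k( x − √ℏ · |A| · conj(U_A) z ) · G(x, z), where P̃_k denotes the unique polynomial function on ℂ^d extending x ↦ P_k(A,ℏ,x). -/

import Mathlib

open Matrix Complex
open scoped ComplexOrder

noncomputable section

/-- The pairing `⟨a, b⟩ = ∑ j, conj (a j) * b j` on `ℂ^d`. -/
def cinner {d : ℕ} (a b : Fin d → ℂ) : ℂ := ∑ j, (starRingEnd ℂ) (a j) * b j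

/-- The embedding of `ℝ^d` into `ℂ^d`. -/
def cvec {d : ℕ} (x : Fin d → ℝ) : Fin d → ℂ := fun j => (x j : ℂ)

/-- The `l`-th standard basis vector of `ℂ^d`. -/
def stdC {d : ℕ} (l : Fin d) : Fin d → ℂ := Pi.single l 1

/-- The gradient of `ψ : ℝ^d → ℂ`, viewed as the vector of partial derivatives. -/
def grad {d : ℕ} (ψ : (Fin d → ℝ) → ℂ) (x : Fin d → ℝ) : Fin d → ℂ :=
  fun j => fderiv ℝ ψ x (Pi.single j 1)

/-- The raising operator `R_l` built from `(A, B)` at semiclassical parameter `h`. -/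
def raiseOp {d : ℕ} (A B : Matrix (Fin d) (Fin d) ℂ) (h : ℝ) (l : Fin d)
    (ψ : (Fin d → ℝ) → ℂ) : (Fin d → ℝ) → ℂ := fun x =>
  ((Real.sqrt (2 * h) : ℝ) : ℂ)⁻¹ *
    (cinner (B.mulVec (stdC l)) (cvec x) * ψ x
      - (h : ℂ) * cinner (A.mulVec (stdC l)) (grad ψ x))

/-- The ground state Gaussian `φ₀`, where `sqrtA` is a fixed branch of `√(det A)`. -/
def phi0 {d : ℕ} (A B : Matrix (Fin d) (Fin d) ℂ) (h : ℝ) (sqrtA : ℂ)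
    (x : Fin d → ℝ) : ℂ :=
  ((Real.pi ^ (-(d : ℝ) / 4) * h ^ (-(d : ℝ) / 4) : ℝ) : ℂ) * sqrtA⁻¹ *
    Complex.exp (-(cinner (cvec x) ((B * A⁻¹).mulVec (cvec x)) / ((2 * h : ℝ) : ℂ)))

/-- `R_1^{k_1} ∘ ⋯ ∘ R_d^{k_d}` for a family of operators `R` and a multi-index `k`. -/
def opPow {d : ℕ} {α : Type*} (R : Fin d → (α → α)) (k : Fin d → ℕ) : α → α :=
  (List.finRange d).foldr (fun l f => (R l)^[k l] ∘ f) id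

/-- The polynomials `P_k(A, h, x)`:
`P_k = 2^{|k|/2} (R_1^{k_1} ∘ ⋯ ∘ R_d^{k_d} φ₀)(x) / φ₀(x)`. -/
def Ppoly {d : ℕ} (A B : Matrix (Fin d) (Fin d) ℂ) (h : ℝ) (sqrtA : ℂ)
    (k : Fin d → ℕ) (x : Fin d → ℝ) : ℂ :=
  (((2 : ℝ) ^ (((∑ l, k l : ℕ) : ℝ) / 2) : ℝ) : ℂ) *
    opPow (raiseOp A B h) k (phi0 A B h sqrtA) x / phi0 A B h sqrtA x

/-- The coordinate partial derivative `∂_j` acting on functions on `ℝ^d`. -/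
def pdC {d : ℕ} (j : Fin d) (f : (Fin d → ℝ) → ℂ) : (Fin d → ℝ) → ℂ :=
  fun x => fderiv ℝ f x (Pi.single j 1)

/-- The generating function
`G(x,z) = exp(−⟨conj z, A⁻¹ conj(A) z⟩ + (2/√h) ⟨conj z, A⁻¹ x⟩)`. -/
def Gfun {d : ℕ} (A : Matrix (Fin d) (Fin d) ℂ) (h : ℝ) (x : Fin d → ℝ)
    (z : Fin d → ℂ) : ℂ :=
  Complex.exp
    (-(cinner (fun j => (starRingEnd ℂ) (z j)) ((A⁻¹ * A.map (starRingEnd ℂ)).mulVec z))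
      + (2 / ((Real.sqrt h : ℝ) : ℂ)) *
          cinner (fun j => (starRingEnd ℂ) (z j)) (A⁻¹.mulVec (cvec x)))

/-- The holomorphic partial derivative `∂/∂z_l` of a function on `ℂ^d`. -/
def dz {d : ℕ} (l : Fin d) (f : (Fin d → ℂ) → ℂ) : (Fin d → ℂ) → ℂ :=
  fun z => deriv (fun t => f (Function.update z l t)) (z l)

/-! ### Iterating families of operators -/

theorem opPow_semiconj {d : ℕ} {α β : Type*} {F : α → β} {T : Fin d → α → α}
    {R : Fin d → β → β} (h : ∀ l, Function.Semiconj F (T l) (R l)) (k : Fin d → ℕ) :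
    Function.Semiconj F (opPow T k) (opPow R k) := by
  unfold opPow
  induction List.finRange d with
  | nil => exact Function.Semiconj.id_right
  | cons l L ih => exact ((h l).iterate_right (k l)).comp_right ih

theorem opPow_smul {d : ℕ} {K V : Type*} [CommSemiring K] [AddCommMonoid V] [Module K V]
    (c : K) (T : Fin d → Module.End K V) (k : Fin d → ℕ) (v : V) :
    opPow (fun l => ⇑(c • T l)) k v = c ^ (∑ l, k l) • opPow (fun l => ⇑(T l)) k v := by
  rw [← List.sum_ofFn, List.ofFn_eq_map]
  unfold opPow
  induction List.finRange d with
  | nil => simp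
  | cons l L ih =>
    simp only [List.foldr_cons, Function.comp_apply, List.map_cons, List.sum_cons, ih]
    rw [← Module.End.coe_pow, ← Module.End.coe_pow, smul_pow, LinearMap.smul_apply, map_smul,
      smul_smul, pow_add]

/-! ### Derivatives along curves in `ℂ^d` -/

section Curves

variable {𝕜 ι : Type*} [NontriviallyNormedField 𝕜] [NormedAlgebra 𝕜 ℂ] [Fintype ι]
  {v : 𝕜 → ι → ℂ} {v' : ι → ℂ} {t : 𝕜}

theorem HasDerivAt.mvPolynomial_eval (hv : HasDerivAt v v' t) (p : MvPolynomial ι ℂ) :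
    HasDerivAt (fun s => MvPolynomial.eval (v s) p)
      (∑ j, v' j * MvPolynomial.eval (v t) (MvPolynomial.pderiv j p)) t := by
  classical
  induction p using MvPolynomial.induction_on with
  | C a => simpa using hasDerivAt_const t a
  | add p q hp hq => simpa [mul_add, Finset.sum_add_distrib] using hp.fun_add hq
  | mul_X p i hp =>
    simp only [map_mul, MvPolynomial.eval_X]
    refine (hp.fun_mul (hasDerivAt_pi.1 hv i)).congr_deriv ?_
    simp [MvPolynomial.pderiv_X, mul_add, Finset.sum_add_distrib,
      Pi.single_apply, Finset.sum_mul, mul_assoc, apply_ite]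
    rw [add_comm, mul_comm (v' i)]
    refine congrArg _ (Finset.sum_congr rfl fun j _ => ?_)
    ring

theorem HasDerivAt.dotProduct_const_left (hv : HasDerivAt v v' t) (a : ι → ℂ) :
    HasDerivAt (fun s => a ⬝ᵥ v s) (a ⬝ᵥ v') t := by
  unfold dotProduct
  exact HasDerivAt.fun_sum fun i _ => (hasDerivAt_pi.1 hv i).const_mul (a i)

theorem HasDerivAt.mulVec_const {κ : Type*} [Fintype κ] (hv : HasDerivAt v v' t)
    (M : Matrix κ ι ℂ) : HasDerivAt (fun s => M *ᵥ v s) (M *ᵥ v') t :=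
  hasDerivAt_pi.2 fun i => hv.dotProduct_const_left (M i)

theorem HasDerivAt.dotProduct_mulVec_self (hv : HasDerivAt v v' t) {M : Matrix ι ι ℂ}
    (hM : Mᵀ = M) :
    HasDerivAt (fun s => v s ⬝ᵥ M *ᵥ v s) (2 * (v' ⬝ᵥ M *ᵥ v t)) t := by
  have key : v t ⬝ᵥ M *ᵥ v' = v' ⬝ᵥ M *ᵥ v t := by
    rw [dotProduct_mulVec, ← mulVec_transpose, hM, dotProduct_comm]
  have h : HasDerivAt (fun s => v s ⬝ᵥ M *ᵥ v s) (v' ⬝ᵥ M *ᵥ v t + v t ⬝ᵥ M *ᵥ v') t := by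
    simp only [dotProduct, ← Finset.sum_add_distrib]
    exact HasDerivAt.fun_sum fun i _ =>
      (hasDerivAt_pi.1 hv i).mul (hasDerivAt_pi.1 (hv.mulVec_const M) i)
  rwa [key, ← two_mul] at h

end Curves

/-! ### The raising operator on polynomials -/

section Raise

variable {d : ℕ}

/-- The operator `p ↦ (2/√ℏ) (A⁻¹ X)_l p - √ℏ (A* ∇p)_l` on polynomials, which is
conjugate to `√2 R_l` through multiplication by `φ₀`. -/
def raisePoly (A : Matrix (Fin d) (Fin d) ℂ) (h : ℝ) (l : Fin d) :
    Module.End ℂ (MvPolynomial (Fin d) ℂ) :=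
  LinearMap.mulLeft ℂ
      (MvPolynomial.C (2 / (√h : ℂ)) * ∑ j, MvPolynomial.C (A⁻¹ l j) * MvPolynomial.X j) -
    (√h : ℂ) • ∑ j, Aᴴ l j • (MvPolynomial.pderiv j).toLinearMap

theorem eval_raisePoly (A : Matrix (Fin d) (Fin d) ℂ) (h : ℝ) (l : Fin d)
    (p : MvPolynomial (Fin d) ℂ) (v : Fin d → ℂ) :
    MvPolynomial.eval v (raisePoly A h l p) =
      2 / (√h : ℂ) * (A⁻¹ *ᵥ v) l * MvPolynomial.eval v p -
        √h * ∑ j, Aᴴ l j * MvPolynomial.eval v (MvPolynomial.pderiv j p) := by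
  rw [raisePoly, LinearMap.sub_apply, LinearMap.smul_apply, map_sub, MvPolynomial.smul_eval]
  simp [mulVec, dotProduct, LinearMap.sum_apply, mul_assoc]

theorem cinner_mulVec_stdC (M : Matrix (Fin d) (Fin d) ℂ) (l : Fin d) (v : Fin d → ℂ) :
    cinner (M *ᵥ stdC l) v = (Mᴴ *ᵥ v) l := by
  rw [stdC, mulVec_single_one]
  simp [cinner, mulVec, dotProduct, conjTranspose_apply]

theorem cinner_cvec (x : Fin d → ℝ) (v : Fin d → ℂ) : cinner (cvec x) v = cvec x ⬝ᵥ v := by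
  simp [cinner, cvec, dotProduct]

theorem cinner_conj (z v : Fin d → ℂ) :
    cinner (fun j => (starRingEnd ℂ) (z j)) v = z ⬝ᵥ v := by
  simp [cinner, dotProduct]

theorem hasDerivAt_cvec_line (x : Fin d → ℝ) (j : Fin d) :
    HasDerivAt (fun t : ℝ => cvec (x + t • Pi.single j 1)) (Pi.single j 1) 0 := by
  refine hasDerivAt_pi.2 fun i => ?_
  have h : HasDerivAt (fun t : ℝ => x i + t * (Pi.single j 1 : Fin d → ℝ) i)
      ((Pi.single j 1 : Fin d → ℝ) i) 0 := by
    simpa using ((hasDerivAt_id' (0 : ℝ)).mul_const ((Pi.single j 1 : Fin d → ℝ) i)).const_add (x i)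
  refine h.ofReal_comp.congr_deriv ?_
  by_cases hij : i = j <;> simp [hij]

theorem differentiable_cvec_apply (j : Fin d) :
    Differentiable ℝ fun x : Fin d → ℝ => cvec x j := by
  unfold cvec
  fun_prop

theorem differentiable_eval_cvec (p : MvPolynomial (Fin d) ℂ) :
    Differentiable ℝ fun x : Fin d → ℝ => MvPolynomial.eval (cvec x) p := by
  induction p using MvPolynomial.induction_on with
  | C a => simp
  | add p q hp hq => simpa using hp.fun_add hq
  | mul_X p i hp => simpa using hp.fun_mul (differentiable_cvec_apply i)

theorem differentiable_phi0 (A B : Matrix (Fin d) (Fin d) ℂ) (h : ℝ) (c : ℂ) :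
    Differentiable ℝ (phi0 A B h c) := by
  have := differentiable_cvec_apply (d := d)
  unfold phi0
  simp only [cinner_cvec, dotProduct, mulVec]
  fun_prop

theorem phi0_ne_zero {A B : Matrix (Fin d) (Fin d) ℂ} {h : ℝ} (hh : 0 < h) {c : ℂ}
    (hc : c ≠ 0) (x : Fin d → ℝ) : phi0 A B h c x ≠ 0 := by
  unfold phi0
  refine mul_ne_zero (mul_ne_zero ?_ (inv_ne_zero hc)) (Complex.exp_ne_zero _)
  exact_mod_cast (by positivity : Real.pi ^ (-(d : ℝ) / 4) * h ^ (-(d : ℝ) / 4) ≠ 0)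

theorem grad_eval_mul_phi0 {A B : Matrix (Fin d) (Fin d) ℂ} {h : ℝ} (hh : 0 < h) {c : ℂ}
    (hM : (B * A⁻¹)ᵀ = B * A⁻¹) (p : MvPolynomial (Fin d) ℂ) (x : Fin d → ℝ) :
    grad (fun y => MvPolynomial.eval (cvec y) p * phi0 A B h c y) x = fun j =>
      (MvPolynomial.eval (cvec x) (MvPolynomial.pderiv j p) -
        (h : ℂ)⁻¹ * ((B * A⁻¹) *ᵥ cvec x) j * MvPolynomial.eval (cvec x) p) *
          phi0 A B h c x := by
  funext j
  have hdiff : DifferentiableAt ℝ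
      (fun y => MvPolynomial.eval (cvec y) p * phi0 A B h c y) x :=
    ((differentiable_eval_cvec p).mul (differentiable_phi0 A B h c)) x
  have hx : x + (0 : ℝ) • Pi.single j (1 : ℝ) = x := by simp
  have hline := hasDerivAt_cvec_line x j
  have hpoly := hline.mvPolynomial_eval p
  have hexp := ((hline.dotProduct_mulVec_self hM).div_const
    ((2 * h : ℝ) : ℂ)).fun_neg.cexp.const_mul
    (((Real.pi ^ (-(d : ℝ) / 4) * h ^ (-(d : ℝ) / 4) : ℝ) : ℂ) * c⁻¹)
  have hh' : (h : ℂ) ≠ 0 := by exact_mod_cast hh.ne'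
  rw [grad, ← hdiff.lineDeriv_eq_fderiv, lineDeriv]
  simp only [phi0, cinner_cvec]
  rw [(hpoly.fun_mul hexp).deriv, hx]
  simp [Pi.single_apply]
  field_simp
  ring

theorem raiseOp_eval_mul_phi0 {A B : Matrix (Fin d) (Fin d) ℂ} {h : ℝ} (hh : 0 < h) {c : ℂ}
    (hA : IsUnit A.det)
    (hAB : Aᴴ * B + Bᴴ * A = (2 : ℂ) • (1 : Matrix (Fin d) (Fin d) ℂ))
    (hM : (B * A⁻¹)ᵀ = B * A⁻¹) (l : Fin d) (p : MvPolynomial (Fin d) ℂ) :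
    raiseOp A B h l (fun y => MvPolynomial.eval (cvec y) p * phi0 A B h c y) = fun y =>
      MvPolynomial.eval (cvec y) (((√2 : ℂ)⁻¹ • raisePoly A h l) p) * phi0 A B h c y := by
  have hmat : Bᴴ + Aᴴ * (B * A⁻¹) = (2 : ℂ) • A⁻¹ := by
    calc Bᴴ + Aᴴ * (B * A⁻¹) = (Aᴴ * B + Bᴴ * A) * A⁻¹ := by
          rw [Matrix.add_mul, mul_nonsing_inv_cancel_right _ _ hA, Matrix.mul_assoc, add_comm]
      _ = (2 : ℂ) • A⁻¹ := by rw [hAB, smul_mul, Matrix.one_mul]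
  funext x
  have hvec : (Bᴴ *ᵥ cvec x) l + (Aᴴ *ᵥ ((B * A⁻¹) *ᵥ cvec x)) l = 2 * (A⁻¹ *ᵥ cvec x) l := by
    rw [mulVec_mulVec, ← Pi.add_apply, ← add_mulVec, hmat, smul_mulVec]
    rfl
  have hs : (√h : ℂ) ≠ 0 := by exact_mod_cast (Real.sqrt_pos.2 hh).ne'
  have hsq : (h : ℂ) = √h * √h := by exact_mod_cast (Real.mul_self_sqrt hh.le).symm
  have h2 : (√2 : ℂ) ≠ 0 := by exact_mod_cast (Real.sqrt_pos.2 two_pos).ne'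
  have hgrad : (Aᴴ *ᵥ grad (fun y => MvPolynomial.eval (cvec y) p * phi0 A B h c y) x) l =
      ((∑ j, Aᴴ l j * MvPolynomial.eval (cvec x) (MvPolynomial.pderiv j p)) -
        (h : ℂ)⁻¹ * (Aᴴ *ᵥ ((B * A⁻¹) *ᵥ cvec x)) l * MvPolynomial.eval (cvec x) p) *
          phi0 A B h c x := by
    rw [grad_eval_mul_phi0 hh hM]
    simp only [mulVec, dotProduct, Finset.mul_sum, Finset.sum_mul, ← Finset.sum_sub_distrib]
    refine Finset.sum_congr rfl fun j _ => ?_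
    simp only [Finset.mul_sum, Finset.sum_mul, mul_sub, sub_mul]
    congr 1
    · ring
    · refine Finset.sum_congr rfl fun i _ => ?_
      ring
  rw [raiseOp, cinner_mulVec_stdC, cinner_mulVec_stdC, hgrad, LinearMap.smul_apply,
    MvPolynomial.smul_eval, eval_raisePoly, Real.sqrt_mul zero_le_two, ofReal_mul,
    eq_sub_of_add_eq hvec, hsq]
  field_simp
  ring

theorem dz_eval_mul_Gfun {A : Matrix (Fin d) (Fin d) ℂ} {h : ℝ} (hh : 0 < h)
    (hC : (A⁻¹ * A.map (starRingEnd ℂ))ᵀ = A⁻¹ * A.map (starRingEnd ℂ))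
    (l : Fin d) (p : MvPolynomial (Fin d) ℂ) (x : Fin d → ℝ) :
    dz l (fun z => MvPolynomial.eval (cvec x - (√h : ℂ) • A.map (starRingEnd ℂ) *ᵥ z) p *
        Gfun A h x z) = fun z =>
      MvPolynomial.eval (cvec x - (√h : ℂ) • A.map (starRingEnd ℂ) *ᵥ z) (raisePoly A h l p) *
        Gfun A h x z := by
  funext z
  have hs : (√h : ℂ) ≠ 0 := by exact_mod_cast (Real.sqrt_pos.2 hh).ne'
  have hz := hasDerivAt_update z l (z l)
  have hpoly := (((hz.mulVec_const (A.map (starRingEnd ℂ))).fun_const_smul (√h : ℂ)).const_sub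
    (cvec x)).mvPolynomial_eval p
  have hexp := ((hz.dotProduct_mulVec_self hC).fun_neg.fun_add
    ((hz.dotProduct_const_left (A⁻¹ *ᵥ cvec x)).const_mul (2 / (√h : ℂ)))).cexp
  have hsum : ∑ j, (-((√h : ℂ) • A.map (starRingEnd ℂ) *ᵥ Pi.single l 1)) j *
        MvPolynomial.eval (cvec x - (√h : ℂ) • A.map (starRingEnd ℂ) *ᵥ z)
          (MvPolynomial.pderiv j p) =
      -(√h * ∑ j, Aᴴ l j * MvPolynomial.eval
        (cvec x - (√h : ℂ) • A.map (starRingEnd ℂ) *ᵥ z) (MvPolynomial.pderiv j p)) := by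
    simp [Finset.mul_sum, conjTranspose_apply, mul_assoc]
  simp only [dz, Gfun, cinner_conj, dotProduct_comm _ (A⁻¹ *ᵥ cvec x)]
  rw [(hpoly.fun_mul hexp).deriv, Function.update_eq_self, hsum, eval_raisePoly,
    mulVec_sub, mulVec_smul, mulVec_mulVec]
  simp only [single_one_dotProduct, dotProduct_single_one, Pi.sub_apply, Pi.smul_apply,
    smul_eq_mul]
  field_simp
  ring

end Raise

/-! ### Consequences of the symplectic relations -/

section Symplectic

variable {n : Type*} [Fintype n] [DecidableEq n] {A B S : Matrix n n ℂ}

theorem transpose_mul_inv_of_transpose_mul_sub_eq_zero (hA : IsUnit A.det)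
    (hAB : Aᵀ * B - Bᵀ * A = 0) : (B * A⁻¹)ᵀ = B * A⁻¹ := by
  have hA' : IsUnit Aᵀ.det := by rwa [det_transpose]
  rw [transpose_mul, transpose_nonsing_inv]
  calc Aᵀ⁻¹ * Bᵀ = Aᵀ⁻¹ * (Bᵀ * A * A⁻¹) := by rw [mul_nonsing_inv_cancel_right _ _ hA]
    _ = B * A⁻¹ := by
      rw [← sub_eq_zero.1 hAB, Matrix.mul_assoc, nonsing_inv_mul_cancel_left _ _ hA']

theorem transpose_mul_conjTranspose_self (hA : IsUnit A.det)
    (hAB : Aᴴ * B + Bᴴ * A = (2 : ℂ) • (1 : Matrix n n ℂ))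
    (hM : (B * A⁻¹)ᵀ = B * A⁻¹) : (A * Aᴴ)ᵀ = A * Aᴴ := by
  have hA' : IsUnit Aᴴ.det := by rw [det_conjTranspose]; exact hA.star
  have hsum : B * A⁻¹ + (B * A⁻¹)ᴴ = (2 : ℂ) • (A * Aᴴ)⁻¹ := by
    calc B * A⁻¹ + (B * A⁻¹)ᴴ = Aᴴ⁻¹ * (Aᴴ * B + Bᴴ * A) * A⁻¹ := by
          rw [Matrix.mul_add, Matrix.add_mul, nonsing_inv_mul_cancel_left _ _ hA',
            ← Matrix.mul_assoc, mul_nonsing_inv_cancel_right _ _ hA, conjTranspose_mul,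
            conjTranspose_nonsing_inv]
      _ = (2 : ℂ) • (A * Aᴴ)⁻¹ := by
          rw [hAB, Matrix.mul_smul, smul_mul, Matrix.mul_one, Matrix.mul_inv_rev]
  have hsymm : (B * A⁻¹ + (B * A⁻¹)ᴴ)ᵀ = B * A⁻¹ + (B * A⁻¹)ᴴ := by
    rw [transpose_add, show (B * A⁻¹)ᴴᵀ = (B * A⁻¹)ᵀᴴ from rfl, hM]
  rw [hsum, transpose_smul, transpose_nonsing_inv] at hsymm
  have hinv := congrArg (·⁻¹) (smul_right_injective _ (two_ne_zero (α := ℂ)) hsymm)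
  have hdet : IsUnit (A * Aᴴ).det := by rw [det_mul]; exact hA.mul hA'
  have hdet' : IsUnit (A * Aᴴ)ᵀ.det := by rwa [det_transpose]
  simpa only [nonsing_inv_nonsing_inv _ hdet, nonsing_inv_nonsing_inv _ hdet'] using hinv

theorem transpose_inv_mul_map_conj (hA : IsUnit A.det) (hAA : (A * Aᴴ)ᵀ = A * Aᴴ) :
    (A⁻¹ * A.map (starRingEnd ℂ))ᵀ = A⁻¹ * A.map (starRingEnd ℂ) := by
  have hA' : IsUnit Aᵀ.det := by rwa [det_transpose]
  have hmap : A.map (starRingEnd ℂ) = Aᴴᵀ := rfl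
  rw [hmap, transpose_mul, transpose_transpose, transpose_nonsing_inv]
  calc Aᴴ * Aᵀ⁻¹ = A⁻¹ * (A * Aᴴ) * Aᵀ⁻¹ := by rw [nonsing_inv_mul_cancel_left _ _ hA]
    _ = A⁻¹ * Aᴴᵀ := by
      rw [← hAA, transpose_mul, ← Matrix.mul_assoc, mul_nonsing_inv_cancel_right _ _ hA']

open scoped MatrixOrder Matrix.Norms.L2Operator in
theorem Matrix.PosSemidef.eq_of_mul_self_eq {T : Matrix n n ℂ} (hS : S.PosSemidef)
    (hT : T.PosSemidef) (h : S * S = T * T) : S = T := by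
  rw [← CFC.sqrt_unique h hS.nonneg, CFC.sqrt_mul_self T hT.nonneg]

theorem mul_map_conj_inv_mul (hS : S.PosDef) (hSS : S * S = A * Aᴴ)
    (hAA : (A * Aᴴ)ᵀ = A * Aᴴ) :
    S * (S⁻¹ * A).map (starRingEnd ℂ) = A.map (starRingEnd ℂ) := by
  have hST : Sᵀ = S := hS.transpose.posSemidef.eq_of_mul_self_eq hS.posSemidef <| by
    rw [← transpose_mul, hSS, hAA]
  have hdet : IsUnit S.det := (isUnit_iff_isUnit_det _).1 hS.isUnit
  change S * (S⁻¹ * A)ᴴᵀ = Aᴴᵀ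
  rw [conjTranspose_mul, transpose_mul, conjTranspose_nonsing_inv, hS.isHermitian.eq,
    transpose_nonsing_inv, hST, mul_nonsing_inv_cancel_left _ _ hdet]

end Symplectic

theorem MvPolynomial.eq_of_eval_cvec_eq {d : ℕ} {p q : MvPolynomial (Fin d) ℂ}
    (h : ∀ y : Fin d → ℝ, MvPolynomial.eval (cvec y) p = MvPolynomial.eval (cvec y) q) :
    p = q := by
  refine MvPolynomial.funext_set (fun _ => Set.range ((↑) : ℝ → ℂ))
    (fun _ => Set.infinite_range_of_injective ofReal_injective) fun v hv => ?_
  choose y hy using fun i => hv i trivial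
  obtain rfl : cvec y = v := _root_.funext hy
  exact h y

theorem Ppoly_eq_eval {d : ℕ} {A B : Matrix (Fin d) (Fin d) ℂ} {h : ℝ} (hh : 0 < h) {c : ℂ}
    (hc : c ≠ 0) (hA : IsUnit A.det)
    (hAB : Aᴴ * B + Bᴴ * A = (2 : ℂ) • (1 : Matrix (Fin d) (Fin d) ℂ))
    (hM : (B * A⁻¹)ᵀ = B * A⁻¹) (k : Fin d → ℕ) (y : Fin d → ℝ) :
    Ppoly A B h c k y =
      MvPolynomial.eval (cvec y) (opPow (fun l => ⇑(raisePoly A h l)) k 1) := by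
  have hiter := opPow_semiconj
    (F := fun p y => MvPolynomial.eval (cvec y) p * phi0 A B h c y)
    (T := fun l => ⇑((√2 : ℂ)⁻¹ • raisePoly A h l)) (R := raiseOp A B h)
    (fun l p => (raiseOp_eval_mul_phi0 hh hA hAB hM l p).symm) k 1
  rw [opPow_smul] at hiter
  simp only [map_one, one_mul] at hiter
  have hpow : (2 : ℝ) ^ (((∑ l, k l : ℕ) : ℝ) / 2) = √2 ^ (∑ l, k l) := by
    rw [Real.sqrt_eq_rpow, ← Real.rpow_mul_natCast zero_le_two]
    congr 1
    ring
  have h2 : (√2 : ℂ) ≠ 0 := by exact_mod_cast (Real.sqrt_pos.2 two_pos).ne'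
  have hphi := phi0_ne_zero (A := A) (B := B) hh hc y
  rw [Ppoly, ← hiter, hpow]
  beta_reduce
  rw [MvPolynomial.smul_eval, ofReal_pow, inv_pow]
  field_simp

/-- Iterated `z`-derivatives of the generating function:
`(∂/∂z)^k G(x,z) = P̃_k(x − √ℏ |A| conj(U_A) z) · G(x,z)`, where `P̃_k` (here `Q`) is the
unique polynomial function on `ℂ^d` extending `x ↦ P_k(A,ℏ,x)`, `S = |A|` is the positive
definite square root of `A A*`, and `U_A = |A|⁻¹ A`. -/
theorem generating_function_iterated_derivatives
    {d : ℕ} (hd : 1 ≤ d) {hbar : ℝ} (hhbar : 0 < hbar)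
    (A B : Matrix (Fin d) (Fin d) ℂ) (hA : IsUnit A.det) (hB : IsUnit B.det)
    (hAB₁ : Aᴴ * B + Bᴴ * A = (2 : ℂ) • (1 : Matrix (Fin d) (Fin d) ℂ))
    (hAB₂ : Aᵀ * B - Bᵀ * A = 0)
    (sqrtA : ℂ) (hsqrtA : sqrtA ^ 2 = A.det)
    (S : Matrix (Fin d) (Fin d) ℂ) (hS : S.PosDef) (hSS : S * S = A * Aᴴ)
    (k : Fin d → ℕ) (Q : MvPolynomial (Fin d) ℂ)
    (hQ : ∀ y : Fin d → ℝ, MvPolynomial.eval (cvec y) Q = Ppoly A B hbar sqrtA k y)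
    (x : Fin d → ℝ) (z : Fin d → ℂ) :
    opPow dz k (Gfun A hbar x) z =
      MvPolynomial.eval
        (fun j => (x j : ℂ) - ((Real.sqrt hbar : ℝ) : ℂ) *
            S.mulVec (((S⁻¹ * A).map (starRingEnd ℂ)).mulVec z) j) Q *
        Gfun A hbar x z := by
  have hM := transpose_mul_inv_of_transpose_mul_sub_eq_zero hA hAB₂
  have hAA := transpose_mul_conjTranspose_self hA hAB₁ hM
  have hc : sqrtA ≠ 0 := by
    rintro rfl
    exact hA.ne_zero (by simpa using hsqrtA.symm)
  obtain rfl : Q = opPow (fun l => ⇑(raisePoly A hbar l)) k 1 :=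
    MvPolynomial.eq_of_eval_cvec_eq fun y =>
      (hQ y).trans (Ppoly_eq_eval hhbar hc hA hAB₁ hM k y)
  have hiter := congrFun (opPow_semiconj
    (F := fun p z => MvPolynomial.eval
      (cvec x - (√hbar : ℂ) • A.map (starRingEnd ℂ) *ᵥ z) p * Gfun A hbar x z)
    (T := fun l => ⇑(raisePoly A hbar l)) (R := dz)
    (fun l p => (dz_eval_mul_Gfun hhbar (transpose_inv_mul_map_conj hA hAA) l p x).symm) k 1) z
  simp only [map_one, one_mul] at hiter
  rw [mulVec_mulVec, mul_map_conj_inv_mul hS hSS hAA]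
  exact hiter.symm

end
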